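/- (Weak completeness.) If a sequent in the language of \, /, ·, ∧, 0, 1 is true in every non-standard square R-model, then it is derivable in L^Λ(∧,0,1). -/

import Mathlib

/-- Formulae of the Lambek calculus with intersection and constants 0 and 1. -/
inductive Fm where
  | var : ℕ → Fm                -- propositional variable
  | zero : Fm                   -- constant 0
  | one : Fm                    -- constant 1
  | mul : Fm → Fm → Fm          -- product A·B
  | ldiv : Fm → Fm → Fm         -- left division A\B
  | rdiv : Fm → Fm → Fm         -- right division B/A
  | inter : Fm → Fm → Fm        -- intersection A∧B

/-- Derivability of sequents in `L^Λ(∧,0,1)` from a set `H` of extra (non-logical)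
axioms.  A sequent is a pair of a list of formulae (antecedent) and a formula
(succedent). -/
inductive Deriv (H : Set (List Fm × Fm)) : List Fm → Fm → Prop
  | hyp {P B} : (P, B) ∈ H → Deriv H P B
  | id (A) : Deriv H [A] A
  | oneR : Deriv H [] Fm.one
  | zeroL (Γ Δ C) : Deriv H (Γ ++ [Fm.zero] ++ Δ) C
  | cut {P A Γ Δ C} : Deriv H P A → Deriv H (Γ ++ [A] ++ Δ) C →
      Deriv H (Γ ++ P ++ Δ) C
  | ldivL {P A Γ B Δ C} : Deriv H P A → Deriv H (Γ ++ [B] ++ Δ) C →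
      Deriv H (Γ ++ P ++ [Fm.ldiv A B] ++ Δ) C
  | ldivR {P A B} : Deriv H (A :: P) B → Deriv H P (Fm.ldiv A B)
  | rdivL {P A Γ B Δ C} : Deriv H P A → Deriv H (Γ ++ [B] ++ Δ) C →
      Deriv H (Γ ++ [Fm.rdiv B A] ++ P ++ Δ) C
  | rdivR {P A B} : Deriv H (P ++ [A]) B → Deriv H P (Fm.rdiv B A)
  | mulL {Γ A B Δ C} : Deriv H (Γ ++ [A, B] ++ Δ) C →
      Deriv H (Γ ++ [Fm.mul A B] ++ Δ) C
  | mulR {P A Δ B} : Deriv H P A → Deriv H Δ B → Deriv H (P ++ Δ) (Fm.mul A B)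
  | andL1 {Γ A B Δ C} : Deriv H (Γ ++ [A] ++ Δ) C →
      Deriv H (Γ ++ [Fm.inter A B] ++ Δ) C
  | andL2 {Γ A B Δ C} : Deriv H (Γ ++ [B] ++ Δ) C →
      Deriv H (Γ ++ [Fm.inter A B] ++ Δ) C
  | andR {P A B} : Deriv H P A → Deriv H P B → Deriv H P (Fm.inter A B)
  | oneL {Γ Δ C} : Deriv H (Γ ++ Δ) C → Deriv H (Γ ++ [Fm.one] ++ Δ) C
/-- Relational composition of binary relations on `W`. -/
def rcomp {W : Type} (R S : Set (W × W)) : Set (W × W) :=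
  {p | ∃ y, (p.1, y) ∈ R ∧ (y, p.2) ∈ S}

/-- Left residual `R \ S`. -/
def lres {W : Type} (R S : Set (W × W)) : Set (W × W) :=
  {p | ∀ x, (x, p.1) ∈ R → (x, p.2) ∈ S}

/-- Right residual `S / R`. -/
def rres {W : Type} (S R : Set (W × W)) : Set (W × W) :=
  {p | ∀ z, (p.2, z) ∈ R → (p.1, z) ∈ S}

/-- The diagonal relation `δ`. -/
def diag {W : Type} : Set (W × W) := {p | p.1 = p.2}

/-- A non-standard square R-model over a (non-empty) set `W`. -/
structure NSModel (W : Type) where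
  famA : Set (Set (W × W))
  unit : Set (W × W)
  zero : Set (W × W)
  v : Fm → Set (W × W)
  closed_comp : ∀ R ∈ famA, ∀ S ∈ famA, rcomp R S ∈ famA
  closed_lres : ∀ R ∈ famA, ∀ S ∈ famA, lres R S ∈ famA
  closed_rres : ∀ S ∈ famA, ∀ R ∈ famA, rres S R ∈ famA
  closed_inter : ∀ R ∈ famA, ∀ S ∈ famA, R ∩ S ∈ famA
  unit_mem : unit ∈ famA
  zero_mem : zero ∈ famA
  unit_comp : ∀ R ∈ famA, rcomp unit R = R
  comp_unit : ∀ R ∈ famA, rcomp R unit = R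
  zero_least : ∀ R ∈ famA, zero ⊆ R
  v_mem : ∀ A, v A ∈ famA
  v_mul : ∀ A B, v (Fm.mul A B) = rcomp (v A) (v B)
  v_ldiv : ∀ A B, v (Fm.ldiv A B) = lres (v A) (v B)
  v_rdiv : ∀ B A, v (Fm.rdiv B A) = rres (v B) (v A)
  v_inter : ∀ A B, v (Fm.inter A B) = v A ∩ v B
  v_one : v Fm.one = unit
  v_zero : v Fm.zero = zero

/-- Interpretation of an antecedent: `v(A₁)∘…∘v(Aₙ)`, with `δ` for the empty list. -/
def NSModel.vList {W : Type} (M : NSModel W) : List Fm → Set (W × W)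
  | [] => diag
  | A :: Γ => rcomp (M.v A) (M.vList Γ)

/-- Truth of a sequent in a non-standard square R-model. -/
def NSModel.seqTrue {W : Type} (M : NSModel W) (s : List Fm × Fm) : Prop :=
  M.vList s.1 ⊆ M.v s.2

namespace Fm

/-- An injective numbering of formulae. -/
def code : Fm → ℕ
  | var n => Nat.pair 0 n
  | zero => Nat.pair 1 0
  | one => Nat.pair 2 0
  | mul A B => Nat.pair 3 (Nat.pair A.code B.code)
  | ldiv A B => Nat.pair 4 (Nat.pair A.code B.code)
  | rdiv A B => Nat.pair 5 (Nat.pair A.code B.code)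
  | inter A B => Nat.pair 6 (Nat.pair A.code B.code)

theorem code_injective : Function.Injective code := by
  intro A
  induction A with
  | var n => intro B h; cases B <;> simp_all [code, Nat.pair_eq_pair]
  | zero => intro B h; cases B <;> simp_all [code, Nat.pair_eq_pair]
  | one => intro B h; cases B <;> simp_all [code, Nat.pair_eq_pair]
  | mul A₁ A₂ h₁ h₂ | ldiv A₁ A₂ h₁ h₂ | rdiv A₁ A₂ h₁ h₂ | inter A₁ A₂ h₁ h₂ =>
    intro B h
    cases B <;> simp [code, Nat.pair_eq_pair] at h
    exact congrArg₂ _ (h₁ h.1) (h₂ h.2)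

instance : Countable Fm := code_injective.countable

/-- The order of the Lindenbaum algebra: derivability of `A → B` in the pure calculus. -/
def Le (A B : Fm) : Prop := Deriv ∅ [A] B

theorem Le.refl (A : Fm) : Le A A := Deriv.id A

theorem Le.trans {A B C : Fm} (h₁ : Le A B) (h₂ : Le B C) : Le A C :=
  Deriv.cut (Γ := []) (Δ := []) h₁ h₂

theorem Le.mul_mono {A A' B B' : Fm} (h₁ : Le A A') (h₂ : Le B B') :
    Le (mul A B) (mul A' B') :=
  Deriv.mulL (Γ := []) (Δ := []) (Deriv.mulR (P := [A]) h₁ h₂)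

theorem mul_assoc_le (A B C : Fm) : Le (mul (mul A B) C) (mul A (mul B C)) :=
  Deriv.mulL (Γ := []) (Δ := []) <| Deriv.mulL (Γ := []) (Δ := [C]) <|
    Deriv.mulR (P := [A]) (.id A) (Deriv.mulR (P := [B]) (.id B) (.id C))

theorem le_mul_assoc (A B C : Fm) : Le (mul A (mul B C)) (mul (mul A B) C) :=
  Deriv.mulL (Γ := []) (Δ := []) <| Deriv.mulL (Γ := [A]) (Δ := []) <|
    Deriv.mulR (P := [A, B]) (Deriv.mulR (P := [A]) (.id A) (.id B)) (.id C)

theorem one_le_iff {A : Fm} : Le one A ↔ Deriv ∅ [] A :=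
  ⟨fun h => Deriv.cut (Γ := []) (Δ := []) .oneR h, fun h => Deriv.oneL (Γ := []) (Δ := []) h⟩

theorem one_mul_le (A : Fm) : Le (mul one A) A :=
  Deriv.mulL (Γ := []) (Δ := []) <| Deriv.oneL (Γ := []) (Δ := [A]) (.id A)

theorem mul_one_le (A : Fm) : Le (mul A one) A :=
  Deriv.mulL (Γ := []) (Δ := []) <| Deriv.oneL (Γ := [A]) (Δ := []) (.id A)

theorem le_mul_of_one_le_left {A B : Fm} (h : Le one A) : Le B (mul A B) :=
  Deriv.mulR (P := []) (one_le_iff.1 h) (.id B)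

theorem le_mul_of_one_le_right {A B : Fm} (h : Le one B) : Le A (mul A B) :=
  Deriv.mulR (P := [A]) (.id A) (one_le_iff.1 h)

theorem le_ldiv_iff {A B C : Fm} : Le C (ldiv A B) ↔ Le (mul A C) B :=
  ⟨fun h => Deriv.mulL (Γ := []) (Δ := []) <| Deriv.cut (Γ := [A]) (Δ := []) h <|
      Deriv.ldivL (P := [A]) (Γ := []) (Δ := []) (.id A) (.id B),
    fun h => Deriv.ldivR <| Deriv.cut (P := [A, C]) (Γ := []) (Δ := [])
      (Deriv.mulR (P := [A]) (.id A) (.id C)) h⟩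

theorem le_rdiv_iff {A B C : Fm} : Le C (rdiv B A) ↔ Le (mul C A) B :=
  ⟨fun h => Deriv.mulL (Γ := []) (Δ := []) <| Deriv.cut (Γ := []) (Δ := [A]) h <|
      Deriv.rdivL (P := [A]) (Γ := []) (Δ := []) (.id A) (.id B),
    fun h => Deriv.rdivR <| Deriv.cut (P := [C, A]) (Γ := []) (Δ := [])
      (Deriv.mulR (P := [C]) (.id C) (.id A)) h⟩

theorem inter_le_left (A B : Fm) : Le (inter A B) A :=
  Deriv.andL1 (Γ := []) (Δ := []) (.id A)

theorem inter_le_right (A B : Fm) : Le (inter A B) B :=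
  Deriv.andL2 (Γ := []) (Δ := []) (.id B)

theorem le_inter {A B C : Fm} (h₁ : Le C A) (h₂ : Le C B) : Le C (inter A B) :=
  Deriv.andR h₁ h₂

theorem zero_le (A : Fm) : Le zero A := Deriv.zeroL [] [] A

/-- The Kleene–Aczel slash: a realizability predicate implying provability. -/
def Slash : Fm → Prop
  | var _ => False
  | zero => False
  | one => True
  | mul A B => A.Slash ∧ B.Slash
  | ldiv A B => Deriv ∅ [] (ldiv A B) ∧ (A.Slash → B.Slash)
  | rdiv B A => Deriv ∅ [] (rdiv B A) ∧ (A.Slash → B.Slash)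
  | inter A B => A.Slash ∧ B.Slash

theorem Slash.deriv {A : Fm} (h : A.Slash) : Deriv ∅ [] A := by
  induction A with
  | var n => exact h.elim
  | zero => exact h.elim
  | one => exact .oneR
  | mul A B h₁ h₂ => exact Deriv.mulR (h₁ h.1) (h₂ h.2)
  | ldiv A B => exact h.1
  | rdiv B A => exact h.1
  | inter A B h₁ h₂ => exact Deriv.andR (h₁ h.1) (h₂ h.2)

end Fm

/-- Provable formulae in the middle of an antecedent can be cut out. -/
theorem Deriv.cut_slash (Γ Δ : List Fm) {P : List Fm} {B : Fm} (hP : ∀ A ∈ P, A.Slash)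
    (h : Deriv ∅ (Γ ++ P ++ Δ) B) : Deriv ∅ (Γ ++ Δ) B := by
  induction P with
  | nil => simpa using h
  | cons A P ih =>
    refine ih (fun C hC => hP C (by simp [hC])) ?_
    have := Deriv.cut (Γ := Γ) (Δ := P ++ Δ) (hP A (by simp)).deriv (by simpa using h)
    simpa using this

theorem Deriv.slash {P : List Fm} {B : Fm} (h : Deriv ∅ P B) (hP : ∀ A ∈ P, A.Slash) :
    B.Slash := by
  induction h with
  | hyp h => exact h.elim
  | id A => exact hP A (by simp)
  | oneR => trivial
  | zeroL => exact (hP Fm.zero (by simp)).elim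
  | cut _ _ h₁ h₂ => simp only [List.mem_append, List.mem_singleton] at *; grind
  | ldivL _ _ h₁ h₂ =>
    simp only [List.mem_append, List.mem_singleton] at *
    have := (hP _ (Or.inl (Or.inr rfl))).2
    grind
  | rdivL _ _ h₁ h₂ =>
    simp only [List.mem_append, List.mem_singleton] at *
    have := (hP _ (Or.inl (Or.inl (Or.inr rfl)))).2
    grind
  | @ldivR P A B d ih =>
    refine ⟨Deriv.ldivR (Deriv.cut_slash [A] [] hP (by simpa using d)), fun hA => ih ?_⟩
    simpa [hA] using hP
  | @rdivR P A B d ih =>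
    refine ⟨Deriv.rdivR (Deriv.cut_slash [] [A] hP (by simpa using d)), fun hA => ih ?_⟩
    rintro C hC
    rcases List.mem_append.1 hC with hC | hC
    · exact hP C hC
    · rwa [List.mem_singleton.1 hC]
  | @mulL Γ A B Δ C _ ih =>
    have := hP (A.mul B) (by simp)
    simp only [Fm.Slash] at this
    simp only [List.mem_append, List.mem_cons] at *
    grind
  | mulR _ _ h₁ h₂ =>
    exact ⟨h₁ fun C hC => hP C (by simp [hC]), h₂ fun C hC => hP C (by simp [hC])⟩
  | @andL1 Γ A B Δ C _ ih | @andL2 Γ A B Δ C _ ih =>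
    have := hP (A.inter B) (by simp)
    simp only [Fm.Slash] at this
    simp only [List.mem_append, List.mem_cons] at *
    grind
  | andR _ _ h₁ h₂ => exact ⟨h₁ hP, h₂ hP⟩
  | oneL _ ih => simp only [List.mem_append, List.mem_cons] at *; grind

/-- The unit is prime with respect to the product. -/
theorem Fm.one_le_of_one_le_mul {A B : Fm} (h : Le one (mul A B)) : Le one A ∧ Le one B := by
  have hs : (mul A B).Slash := (one_le_iff.1 h).slash (by simp)
  exact ⟨one_le_iff.2 hs.1.deriv, one_le_iff.2 hs.2.deriv⟩

open Fm

/-- Graphs on an initial segment of `ℕ` (of length `n`) whose edges are labelled by filters of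
formulae; they are reflexive, with loops labelled by the filter of `1`, transitive and acyclic. -/
structure IsNetwork (n : ℕ) (E : ℕ → ℕ → Fm → Prop) : Prop where
  supp : ∀ {p q A}, E p q A → p < n ∧ q < n
  up : ∀ {p q A B}, E p q A → Le A B → E p q B
  inter : ∀ {p q A B}, E p q A → E p q B → E p q (A.inter B)
  trans : ∀ {p q r A B}, E p q A → E q r B → E p r (A.mul B)
  loop : ∀ {p A}, E p p A → Le one A
  refl : ∀ {p}, p < n → E p p one
  antisymm : ∀ {p q A B}, E p q A → E q p B → p = q

/-- A request for a new point: an optional edge into it and an optional edge out of it, each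
given by its other endpoint and its label. -/
abbrev Request := Option (ℕ × Fm) × Option (ℕ × Fm)

/-- A request can be met if its two edges form a detour for a proper edge. -/
def Request.Valid (t : Request) (E : ℕ → ℕ → Fm → Prop) : Prop :=
  ∀ x A z B, t.1 = some (x, A) → t.2 = some (z, B) → E x z (A.mul B) ∧ x ≠ z

/-- Labels of edges from `w` into the requested point. -/
def Request.into (t : Request) (E : ℕ → ℕ → Fm → Prop) (w : ℕ) (C : Fm) : Prop :=
  t.Valid E ∧ ∃ x A, t.1 = some (x, A) ∧ ∃ D, E w x D ∧ Le (D.mul A) C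

/-- Labels of edges from the requested point to `w`. -/
def Request.outOf (t : Request) (E : ℕ → ℕ → Fm → Prop) (w : ℕ) (C : Fm) : Prop :=
  t.Valid E ∧ ∃ z B, t.2 = some (z, B) ∧ ∃ D, E z w D ∧ Le (B.mul D) C

/-- The network with a new point `n` meeting a request. -/
def Request.extend (t : Request) (n : ℕ) (E : ℕ → ℕ → Fm → Prop) (p q : ℕ) (C : Fm) : Prop :=
  E p q C ∨ (p = n ∧ q = n ∧ Le one C) ∨ (p = n ∧ t.outOf E q C) ∨ (q = n ∧ t.into E p C)

section extension

variable {n : ℕ} {E : ℕ → ℕ → Fm → Prop} {t : Request}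

theorem IsNetwork.into_lt (hE : IsNetwork n E) {w C} (h : t.into E w C) : w < n := by
  obtain ⟨-, x, A, -, D, h, -⟩ := h
  exact (hE.supp h).1

theorem IsNetwork.outOf_lt (hE : IsNetwork n E) {w C} (h : t.outOf E w C) : w < n := by
  obtain ⟨-, x, A, -, D, h, -⟩ := h
  exact (hE.supp h).2

theorem Request.into_up {w C C'} (h : t.into E w C) (hC : Le C C') : t.into E w C' := by
  obtain ⟨hv, x, A, ht, D, hD, hle⟩ := h
  exact ⟨hv, x, A, ht, D, hD, hle.trans hC⟩

theorem Request.outOf_up {w C C'} (h : t.outOf E w C) (hC : Le C C') : t.outOf E w C' := by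
  obtain ⟨hv, x, A, ht, D, hD, hle⟩ := h
  exact ⟨hv, x, A, ht, D, hD, hle.trans hC⟩

theorem IsNetwork.into_inter (hE : IsNetwork n E) {w C C'} (h : t.into E w C)
    (h' : t.into E w C') : t.into E w (C.inter C') := by
  obtain ⟨hv, x, A, ht, D, hD, hle⟩ := h
  obtain ⟨-, x', A', ht', D', hD', hle'⟩ := h'
  obtain ⟨rfl, rfl⟩ : x = x' ∧ A = A' := by simpa [ht] using ht'
  exact ⟨hv, x, A, ht, D.inter D', hE.inter hD hD',
    le_inter (((inter_le_left _ _).mul_mono (.refl _)).trans hle)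
      (((inter_le_right _ _).mul_mono (.refl _)).trans hle')⟩

theorem IsNetwork.outOf_inter (hE : IsNetwork n E) {w C C'} (h : t.outOf E w C)
    (h' : t.outOf E w C') : t.outOf E w (C.inter C') := by
  obtain ⟨hv, x, A, ht, D, hD, hle⟩ := h
  obtain ⟨-, x', A', ht', D', hD', hle'⟩ := h'
  obtain ⟨rfl, rfl⟩ : x = x' ∧ A = A' := by simpa [ht] using ht'
  exact ⟨hv, x, A, ht, D.inter D', hE.inter hD hD',
    le_inter ((Le.mul_mono (.refl _) (inter_le_left _ _)).trans hle)
      ((Le.mul_mono (.refl _) (inter_le_right _ _)).trans hle')⟩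

theorem IsNetwork.trans_into (hE : IsNetwork n E) {p q A B} (h : E p q A)
    (h' : t.into E q B) : t.into E p (A.mul B) := by
  obtain ⟨hv, x, F, ht, D, hD, hle⟩ := h'
  exact ⟨hv, x, F, ht, A.mul D, hE.trans h hD,
    (mul_assoc_le _ _ _).trans (Le.mul_mono (.refl _) hle)⟩

theorem IsNetwork.outOf_trans (hE : IsNetwork n E) {q r A B} (h : t.outOf E q A)
    (h' : E q r B) : t.outOf E r (A.mul B) := by
  obtain ⟨hv, x, F, ht, D, hD, hle⟩ := h
  exact ⟨hv, x, F, ht, D.mul B, hE.trans hD h',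
    (le_mul_assoc _ _ _).trans (hle.mul_mono (.refl _))⟩

theorem IsNetwork.into_outOf (hE : IsNetwork n E) {p r A B} (h : t.into E p A)
    (h' : t.outOf E r B) : E p r (A.mul B) := by
  obtain ⟨hv, x, F, ht, D, hD, hle⟩ := h
  obtain ⟨-, z, F', ht', D', hD', hle'⟩ := h'
  refine hE.up (hE.trans (hE.trans hD (hv x F z F' ht ht').1) hD') ?_
  exact ((le_mul_assoc _ _ _).mul_mono (.refl _)).trans
    ((mul_assoc_le _ _ _).trans (hle.mul_mono hle'))

theorem IsNetwork.not_outOf_into (hE : IsNetwork n E) {q A B} (h : t.outOf E q A)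
    (h' : t.into E q B) : False := by
  obtain ⟨hv, z, F, ht, D, hD, -⟩ := h
  obtain ⟨-, x, F', ht', D', hD', -⟩ := h'
  obtain ⟨hxz, hne⟩ := hv _ _ _ _ ht' ht
  exact hne (hE.antisymm hxz (hE.trans hD hD'))

theorem IsNetwork.extend (hE : IsNetwork n E) : IsNetwork (n + 1) (t.extend n E) where
  supp := by
    rintro p q A (h | ⟨rfl, rfl, -⟩ | ⟨rfl, h⟩ | ⟨rfl, h⟩)
    · have := hE.supp h; omega
    · omega
    · have := hE.outOf_lt h; omega
    · have := hE.into_lt h; omega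
  up := by
    rintro p q A B (h | ⟨hp, hq, h⟩ | ⟨hp, h⟩ | ⟨hq, h⟩) hle
    · exact .inl (hE.up h hle)
    · exact .inr (.inl ⟨hp, hq, h.trans hle⟩)
    · exact .inr (.inr (.inl ⟨hp, Request.outOf_up h hle⟩))
    · exact .inr (.inr (.inr ⟨hq, Request.into_up h hle⟩))
  inter := by
    rintro p q A B (h | ⟨hp, hq, h⟩ | ⟨hp, h⟩ | ⟨hq, h⟩)
      (h' | ⟨hp', hq', h'⟩ | ⟨hp', h'⟩ | ⟨hq', h'⟩)
    case inl.inl => exact .inl (hE.inter h h')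
    case inr.inl.inr.inl => exact .inr (.inl ⟨hp, hq, le_inter h h'⟩)
    case inr.inr.inl.inr.inr.inl => exact .inr (.inr (.inl ⟨hp, hE.outOf_inter h h'⟩))
    case inr.inr.inr.inr.inr.inr => exact .inr (.inr (.inr ⟨hq, hE.into_inter h h'⟩))
    all_goals
      have s₁ := @hE.supp p q
      have s₂ := @IsNetwork.into_lt _ _ t hE
      have s₃ := @IsNetwork.outOf_lt _ _ t hE
      grind
  trans := by
    rintro p q r A B (h | ⟨hp, hq, h⟩ | ⟨hp, h⟩ | ⟨hq, h⟩)
      (h' | ⟨hp', hq', h'⟩ | ⟨hp', h'⟩ | ⟨hq', h'⟩)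
    case inl.inl => exact .inl (hE.trans h h')
    case inl.inr.inr.inr => exact .inr (.inr (.inr ⟨hq', hE.trans_into h h'⟩))
    case inr.inl.inr.inl =>
      exact .inr (.inl ⟨hp, hq', h'.trans (le_mul_of_one_le_left h)⟩)
    case inr.inl.inr.inr.inl =>
      exact .inr (.inr (.inl ⟨hp, Request.outOf_up h' (le_mul_of_one_le_left h)⟩))
    case inr.inr.inl.inl => exact .inr (.inr (.inl ⟨hp, hE.outOf_trans h h'⟩))
    case inr.inr.inl.inr.inr.inr => exact (hE.not_outOf_into h h').elim
    case inr.inr.inr.inr.inl =>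
      exact .inr (.inr (.inr ⟨hq', Request.into_up h (le_mul_of_one_le_right h')⟩))
    case inr.inr.inr.inr.inr.inl => exact .inl (hE.into_outOf h h')
    all_goals
      have s₁ := @hE.supp
      have s₂ := @IsNetwork.into_lt _ _ t hE
      have s₃ := @IsNetwork.outOf_lt _ _ t hE
      grind
  loop := by
    rintro p A (h | ⟨-, -, h⟩ | ⟨rfl, h⟩ | ⟨rfl, h⟩)
    · exact hE.loop h
    · exact h
    · exact absurd (hE.outOf_lt h) (lt_irrefl _)
    · exact absurd (hE.into_lt h) (lt_irrefl _)
  refl := by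
    intro p hp
    rcases Nat.lt_succ_iff_lt_or_eq.1 hp with hp | rfl
    · exact .inl (hE.refl hp)
    · exact .inr (.inl ⟨rfl, rfl, .refl _⟩)
  antisymm := by
    rintro p q A B (h | ⟨hp, hq, h⟩ | ⟨hp, h⟩ | ⟨hq, h⟩)
      (h' | ⟨hp', hq', h'⟩ | ⟨hp', h'⟩ | ⟨hq', h'⟩)
    case inl.inl => exact hE.antisymm h h'
    case inr.inr.inl.inr.inr.inr => exact (hE.not_outOf_into h h').elim
    case inr.inr.inr.inr.inr.inl => exact (hE.not_outOf_into h' h).elim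
    all_goals
      have s₁ := @hE.supp
      have s₂ := @IsNetwork.into_lt _ _ t hE
      have s₃ := @IsNetwork.outOf_lt _ _ t hE
      grind

end extension

/-- The networks obtained by meeting a sequence of requests one by one. -/
def network (t : ℕ → Request) : ℕ → ℕ → ℕ → Fm → Prop
  | 0 => fun _ _ _ => False
  | n + 1 => (t n).extend n (network t n)

/-- The union of the networks for a sequence of requests. -/
def limitNetwork (t : ℕ → Request) (p q : ℕ) (A : Fm) : Prop := ∃ n, network t n p q A

section limit

variable {t : ℕ → Request}

theorem isNetwork_network (t : ℕ → Request) (n : ℕ) : IsNetwork n (network t n) := by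
  induction n with
  | zero => constructor <;> simp [network]
  | succ n ih => exact ih.extend

theorem network_mono {m n p q A} (hmn : m ≤ n) (h : network t m p q A) : network t n p q A := by
  induction n, hmn using Nat.le_induction with
  | base => exact h
  | succ n _ ih => exact .inl ih

theorem network_of_le {m n p q A} (hmn : m ≤ n) (hp : p < m) (hq : q < m)
    (h : network t n p q A) : network t m p q A := by
  induction n, hmn using Nat.le_induction with
  | base => exact h
  | succ n hmn ih =>
    rcases h with h | h | h | h
    · exact ih h
    all_goals omega

theorem network_of_limitNetwork {n p q A} (hp : p < n) (hq : q < n) (h : limitNetwork t p q A) :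
    network t n p q A := by
  obtain ⟨m, h⟩ := h
  exact network_of_le (le_max_left n m) hp hq (network_mono (le_max_right n m) h)

theorem limitNetwork_up {p q A B} (h : limitNetwork t p q A) (hle : Le A B) :
    limitNetwork t p q B :=
  h.imp fun n hn => (isNetwork_network t n).up hn hle

theorem limitNetwork_inter {p q A B} (h : limitNetwork t p q A) (h' : limitNetwork t p q B) :
    limitNetwork t p q (A.inter B) := by
  obtain ⟨m, h⟩ := h
  obtain ⟨n, h'⟩ := h'
  exact ⟨max m n, (isNetwork_network t _).inter (network_mono (le_max_left _ _) h)
    (network_mono (le_max_right _ _) h')⟩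

theorem limitNetwork_trans {p q r A B} (h : limitNetwork t p q A) (h' : limitNetwork t q r B) :
    limitNetwork t p r (A.mul B) := by
  obtain ⟨m, h⟩ := h
  obtain ⟨n, h'⟩ := h'
  exact ⟨max m n, (isNetwork_network t _).trans (network_mono (le_max_left _ _) h)
    (network_mono (le_max_right _ _) h')⟩

theorem limitNetwork_loop_iff {p A} : limitNetwork t p p A ↔ Le one A :=
  ⟨fun ⟨n, h⟩ => (isNetwork_network t n).loop h,
    fun h => ⟨p + 1, (isNetwork_network t _).up ((isNetwork_network t _).refl p.lt_succ_self) h⟩⟩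

/-- Every formula is the least label of an edge from any given point. -/
theorem exists_limitNetwork_right (ht : ∀ r N, ∃ n ≥ N, t n = r) (x y : ℕ) (A : Fm) :
    ∃ z, limitNetwork t x z A ∧
      ∀ C, limitNetwork t y z C → ∃ D, limitNetwork t y x D ∧ Le (D.mul A) C := by
  obtain ⟨n, hn, hr⟩ := ht (some (x, A), none) (x + y + 1)
  refine ⟨n, ⟨n + 1, .inr (.inr (.inr ⟨rfl, ?_⟩))⟩, fun C hC => ?_⟩
  · exact ⟨by simp [Request.Valid, hr], x, A, by simp [hr], one,
      (isNetwork_network t n).refl (by omega), one_mul_le A⟩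
  · have h := network_of_limitNetwork (n := n + 1) (by omega) (by omega) hC
    rcases h with h | h | h | ⟨-, -, x', A', hx, D, hD, hle⟩
    · have := (isNetwork_network t n).supp h; omega
    · omega
    · omega
    · obtain ⟨rfl, rfl⟩ : x = x' ∧ A = A' := by simpa [hr] using hx
      exact ⟨D, ⟨n, hD⟩, hle⟩

/-- Every formula is the least label of an edge to any given point. -/
theorem exists_limitNetwork_left (ht : ∀ r N, ∃ n ≥ N, t n = r) (z y : ℕ) (A : Fm) :
    ∃ x, limitNetwork t x z A ∧
      ∀ C, limitNetwork t x y C → ∃ D, limitNetwork t z y D ∧ Le (A.mul D) C := by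
  obtain ⟨n, hn, hr⟩ := ht (none, some (z, A)) (z + y + 1)
  refine ⟨n, ⟨n + 1, .inr (.inr (.inl ⟨rfl, ?_⟩))⟩, fun C hC => ?_⟩
  · exact ⟨by simp [Request.Valid, hr], z, A, by simp [hr], one,
      (isNetwork_network t n).refl (by omega), mul_one_le A⟩
  · have h := network_of_limitNetwork (n := n + 1) (by omega) (by omega) hC
    rcases h with h | h | ⟨-, -, x', A', hx, D, hD, hle⟩ | h
    · have := (isNetwork_network t n).supp h; omega
    · omega
    · obtain ⟨rfl, rfl⟩ : z = x' ∧ A = A' := by simpa [hr] using hx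
      exact ⟨D, ⟨n, hD⟩, hle⟩
    · omega

theorem exists_limitNetwork_mid (ht : ∀ r N, ∃ n ≥ N, t n = r) {x z : ℕ} {A B : Fm}
    (h : limitNetwork t x z (A.mul B)) : ∃ y, limitNetwork t x y A ∧ limitNetwork t y z B := by
  rcases eq_or_ne x z with rfl | hne
  · obtain ⟨hA, hB⟩ := one_le_of_one_le_mul (limitNetwork_loop_iff.1 h)
    exact ⟨x, limitNetwork_loop_iff.2 hA, limitNetwork_loop_iff.2 hB⟩
  obtain ⟨n, hn, hr⟩ := ht (some (x, A), some (z, B)) (x + z + 1)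
  have hv : (t n).Valid (network t n) := by
    rintro x' A' z' B' h₁ h₂
    obtain ⟨rfl, rfl⟩ : x = x' ∧ A = A' := by simpa [hr] using h₁
    obtain ⟨rfl, rfl⟩ : z = z' ∧ B = B' := by simpa [hr] using h₂
    exact ⟨network_of_limitNetwork (by omega) (by omega) h, hne⟩
  refine ⟨n, ⟨n + 1, .inr (.inr (.inr ⟨rfl, ?_⟩))⟩, ⟨n + 1, .inr (.inr (.inl ⟨rfl, ?_⟩))⟩⟩
  · exact ⟨hv, x, A, by simp [hr], one, (isNetwork_network t n).refl (by omega), one_mul_le A⟩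
  · exact ⟨hv, z, B, by simp [hr], one, (isNetwork_network t n).refl (by omega), mul_one_le B⟩

end limit

/-- Some sequence contains every request infinitely often. -/
theorem exists_request_seq : ∃ t : ℕ → Request, ∀ r N, ∃ n ≥ N, t n = r := by
  obtain ⟨f, hf⟩ := exists_surjective_nat Request
  refine ⟨fun n => f n.unpair.1, fun r N => ?_⟩
  obtain ⟨k, rfl⟩ := hf r
  exact ⟨Nat.pair k N, Nat.right_le_pair k N, by simp⟩

/-- Pairs of points whose label contains a given formula. -/
def canonicalVal (t : ℕ → Request) (A : Fm) : Set (ℕ × ℕ) := {p | limitNetwork t p.1 p.2 A}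

section canonical

variable {t : ℕ → Request}

theorem canonicalVal_mono {A B : Fm} (h : Le A B) : canonicalVal t A ⊆ canonicalVal t B :=
  fun _ hp => limitNetwork_up hp h

theorem le_of_canonicalVal_subset (ht : ∀ r N, ∃ n ≥ N, t n = r) {A B : Fm}
    (h : canonicalVal t A ⊆ canonicalVal t B) : Le A B := by
  obtain ⟨z, hz, hmin⟩ := exists_limitNetwork_right ht 0 0 A
  obtain ⟨D, hD, hle⟩ := hmin B (h (a := (0, z)) hz)
  exact (le_mul_of_one_le_left (limitNetwork_loop_iff.1 hD)).trans hle

theorem canonicalVal_mul (ht : ∀ r N, ∃ n ≥ N, t n = r) (A B : Fm) :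
    canonicalVal t (A.mul B) = rcomp (canonicalVal t A) (canonicalVal t B) :=
  Set.ext fun _ => ⟨exists_limitNetwork_mid ht, fun ⟨_, h, h'⟩ => limitNetwork_trans h h'⟩

theorem canonicalVal_ldiv (ht : ∀ r N, ∃ n ≥ N, t n = r) (A B : Fm) :
    canonicalVal t (A.ldiv B) = lres (canonicalVal t A) (canonicalVal t B) := by
  refine Set.ext fun ⟨y, z⟩ => ⟨fun h x hx => ?_, fun h => ?_⟩
  · exact limitNetwork_up (limitNetwork_trans hx h) (le_ldiv_iff.1 (.refl _))
  · obtain ⟨x, hx, hmin⟩ := exists_limitNetwork_left ht y z A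
    obtain ⟨D, hD, hle⟩ := hmin B (h x hx)
    exact limitNetwork_up hD (le_ldiv_iff.2 hle)

theorem canonicalVal_rdiv (ht : ∀ r N, ∃ n ≥ N, t n = r) (B A : Fm) :
    canonicalVal t (B.rdiv A) = rres (canonicalVal t B) (canonicalVal t A) := by
  refine Set.ext fun ⟨y, x⟩ => ⟨fun h z hz => ?_, fun h => ?_⟩
  · exact limitNetwork_up (limitNetwork_trans h hz) (le_rdiv_iff.1 (.refl _))
  · obtain ⟨z, hz, hmin⟩ := exists_limitNetwork_right ht x y A
    obtain ⟨D, hD, hle⟩ := hmin B (h z hz)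
    exact limitNetwork_up hD (le_rdiv_iff.2 hle)

theorem canonicalVal_inter (A B : Fm) :
    canonicalVal t (A.inter B) = canonicalVal t A ∩ canonicalVal t B :=
  Set.ext fun _ => ⟨fun h => ⟨limitNetwork_up h (inter_le_left A B),
    limitNetwork_up h (inter_le_right A B)⟩, fun h => limitNetwork_inter h.1 h.2⟩

/-- The canonical non-standard model. -/
def canonicalModel (ht : ∀ r N, ∃ n ≥ N, t n = r) : NSModel ℕ where
  famA := Set.range (canonicalVal t)
  unit := canonicalVal t one
  zero := canonicalVal t zero
  v := canonicalVal t
  closed_comp := by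
    rintro _ ⟨A, rfl⟩ _ ⟨B, rfl⟩
    exact ⟨_, canonicalVal_mul ht A B⟩
  closed_lres := by
    rintro _ ⟨A, rfl⟩ _ ⟨B, rfl⟩
    exact ⟨_, canonicalVal_ldiv ht A B⟩
  closed_rres := by
    rintro _ ⟨B, rfl⟩ _ ⟨A, rfl⟩
    exact ⟨_, canonicalVal_rdiv ht B A⟩
  closed_inter := by
    rintro _ ⟨A, rfl⟩ _ ⟨B, rfl⟩
    exact ⟨_, canonicalVal_inter A B⟩
  unit_mem := ⟨_, rfl⟩
  zero_mem := ⟨_, rfl⟩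
  unit_comp := by
    rintro _ ⟨A, rfl⟩
    rw [← canonicalVal_mul ht]
    exact (canonicalVal_mono (one_mul_le A)).antisymm
      (canonicalVal_mono (le_mul_of_one_le_left (.refl _)))
  comp_unit := by
    rintro _ ⟨A, rfl⟩
    rw [← canonicalVal_mul ht]
    exact (canonicalVal_mono (mul_one_le A)).antisymm
      (canonicalVal_mono (le_mul_of_one_le_right (.refl _)))
  zero_least := by
    rintro _ ⟨A, rfl⟩
    exact canonicalVal_mono (zero_le A)
  v_mem := fun A => ⟨A, rfl⟩
  v_mul := canonicalVal_mul ht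
  v_ldiv := canonicalVal_ldiv ht
  v_rdiv := canonicalVal_rdiv ht
  v_inter := canonicalVal_inter
  v_one := rfl
  v_zero := rfl

end canonical

/-- A non-empty antecedent is interpreted as the product of its members, from which the
antecedent is inseparable also in derivations. -/
theorem exists_prod {W : Type} (M : NSModel W) (A : Fm) (P : List Fm) :
    ∃ C, M.vList (A :: P) = M.v C ∧ Deriv ∅ (A :: P) C := by
  induction P generalizing A with
  | nil =>
    refine ⟨A, Set.ext fun p => ⟨?_, fun h => ⟨p.2, h, rfl⟩⟩, .id A⟩
    rintro ⟨y, h, rfl : y = p.2⟩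
    exact h
  | cons A' P ih =>
    obtain ⟨C, hC, hd⟩ := ih A'
    refine ⟨A.mul C, ?_, Deriv.mulR (P := [A]) (.id A) hd⟩
    rw [M.v_mul, ← hC, NSModel.vList]

/-- Weak completeness: if a sequent in the language of `\, /, ·, ∧, 0, 1` is true in
every non-standard square R-model, then it is derivable in `L^Λ(∧,0,1)`. -/
theorem weak_completeness (P : List Fm) (B : Fm)
    (h : ∀ (W : Type) [Nonempty W] (M : NSModel W), M.seqTrue (P, B)) :
    Deriv (∅ : Set (List Fm × Fm)) P B := by
  obtain ⟨t, ht⟩ := exists_request_seq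
  have hM := h ℕ (canonicalModel ht)
  cases P with
  | nil => exact one_le_iff.1 (limitNetwork_loop_iff.1 (hM (a := (0, 0)) rfl))
  | cons A P =>
    obtain ⟨C, hC, hd⟩ := exists_prod (canonicalModel ht) A P
    have hle : Le C B := le_of_canonicalVal_subset ht (hC.symm.subset.trans hM)
    simpa using Deriv.cut (Γ := []) (Δ := []) hd hle
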